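/- arXiv:2010.15379 — 6 statements merged into one kernel-verified Lean document; each statement's English description precedes it below -/
import Mathlib

section
/- Let γ denote the standard Gaussian measure on ℝ. Then the infimum over r > 0 of r⁻² · ∫ ((1 − r·z)₊)² dγ(z) equals 1/2. (This is the value δ*(0) = 1/2 of the separability phase-transition threshold at signal strength κ = 0, since at κ = 0 the summary functional c₀(s,r) reduces to E[((1 − r·Z)₊)²].) -/
open MeasureTheory ProbabilityTheory

lemma integrable_sq_gaussianReal : Integrable (fun z : ℝ => z ^ 2) (gaussianReal 0 1) :=
  (memLp_id_gaussianReal (μ := 0) (v := 1) 2).integrable_sq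

lemma integral_sq_gaussianReal : ∫ z, z ^ 2 ∂(gaussianReal 0 1) = 1 := by
  have h := variance_id_gaussianReal (μ := 0) (v := 1)
  rw [variance_eq_integral measurable_id.aemeasurable] at h
  simpa using h

lemma integrable_sq_max_neg_gaussianReal :
    Integrable (fun z : ℝ => (max (-z) 0) ^ 2) (gaussianReal 0 1) := by
  refine integrable_sq_gaussianReal.mono' (by fun_prop) (ae_of_all _ fun z => ?_)
  rw [Real.norm_of_nonneg (sq_nonneg _)]
  rcases max_cases (-z) 0 with h | h <;> rw [h.1] <;> nlinarith

/-- The negative part of a standard Gaussian carries half of its second moment. -/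
lemma integral_sq_max_neg_gaussianReal :
    ∫ z, (max (-z) 0) ^ 2 ∂(gaussianReal 0 1) = 1 / 2 := by
  have hmap : (gaussianReal 0 1).map (fun z : ℝ => -z) = gaussianReal 0 1 := by
    rw [gaussianReal_map_neg, neg_zero]
  have hsymm : ∫ z, (max (-z) 0) ^ 2 ∂(gaussianReal 0 1)
      = ∫ z, (max z 0) ^ 2 ∂(gaussianReal 0 1) := by
    conv_rhs => rw [← hmap]
    rw [integral_map (by fun_prop) (by fun_prop)]
  have hsplit (z : ℝ) : (max z 0) ^ 2 = z ^ 2 - (max (-z) 0) ^ 2 := by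
    rcases le_total z 0 with h | h
    · rw [max_eq_right h, max_eq_left (by linarith)]; ring
    · rw [max_eq_left h, max_eq_right (by linarith)]; ring
  rw [integral_congr_ae (ae_of_all _ hsplit), integral_sub integrable_sq_gaussianReal integrable_sq_max_neg_gaussianReal,
    integral_sq_gaussianReal] at hsymm
  linarith

lemma sq_mul_sq_max_neg_le {r : ℝ} (hr : 0 < r) (z : ℝ) :
    r ^ 2 * (max (-z) 0) ^ 2 ≤ (max (1 - r * z) 0) ^ 2 := by
  rw [← mul_pow, mul_max_of_nonneg _ _ hr.le]
  gcongr <;> linarith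

lemma sq_max_one_sub_mul_le {r : ℝ} (hr : 0 < r) (z : ℝ) :
    (max (1 - r * z) 0) ^ 2 ≤ 1 + r * (1 + z ^ 2) + r ^ 2 * (max (-z) 0) ^ 2 := by
  have h0 : 0 ≤ max (-z) 0 := le_max_right _ _
  have h1 : max (1 - r * z) 0 ≤ 1 + r * max (-z) 0 :=
    max_le (by nlinarith [le_max_left (-z) 0]) (by positivity)
  have h2 : 2 * max (-z) 0 ≤ 1 + z ^ 2 := by
    rcases max_cases (-z) 0 with h | h <;> rw [h.1] <;> nlinarith [sq_nonneg (z + 1)]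
  calc (max (1 - r * z) 0) ^ 2 ≤ (1 + r * max (-z) 0) ^ 2 := by gcongr
    _ ≤ _ := by nlinarith [mul_le_mul_of_nonneg_left h2 hr.le]

lemma integrable_upper_bound_gaussianReal (r : ℝ) :
    Integrable (fun z : ℝ => 1 + r * (1 + z ^ 2) + r ^ 2 * (max (-z) 0) ^ 2)
      (gaussianReal 0 1) :=
  ((integrable_const _).add
    (((integrable_const _).add integrable_sq_gaussianReal).const_mul r)).add
    (integrable_sq_max_neg_gaussianReal.const_mul _)

lemma integrable_sq_max_one_sub_mul_gaussianReal {r : ℝ} (hr : 0 < r) :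
    Integrable (fun z : ℝ => (max (1 - r * z) 0) ^ 2) (gaussianReal 0 1) := by
  refine (integrable_upper_bound_gaussianReal r).mono' (by fun_prop) (ae_of_all _ fun z => ?_)
  rw [Real.norm_of_nonneg (sq_nonneg _)]
  exact sq_max_one_sub_mul_le hr z

lemma le_integral_sq_max_one_sub_mul_gaussianReal {r : ℝ} (hr : 0 < r) :
    r ^ 2 / 2 ≤ ∫ z, (max (1 - r * z) 0) ^ 2 ∂(gaussianReal 0 1) := by
  have h := integral_mono (integrable_sq_max_neg_gaussianReal.const_mul (r ^ 2))
    (integrable_sq_max_one_sub_mul_gaussianReal hr) (sq_mul_sq_max_neg_le hr)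
  rw [integral_const_mul, integral_sq_max_neg_gaussianReal] at h
  linarith

lemma integral_sq_max_one_sub_mul_gaussianReal_le {r : ℝ} (hr : 0 < r) :
    ∫ z, (max (1 - r * z) 0) ^ 2 ∂(gaussianReal 0 1) ≤ 1 + 2 * r + r ^ 2 / 2 := by
  have h := integral_mono (integrable_sq_max_one_sub_mul_gaussianReal hr)
    (integrable_upper_bound_gaussianReal r) (sq_max_one_sub_mul_le hr)
  have hsq : Integrable (fun z : ℝ => 1 + z ^ 2) (gaussianReal 0 1) :=
    (integrable_const _).add integrable_sq_gaussianReal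
  have hlin : Integrable (fun z : ℝ => 1 + r * (1 + z ^ 2)) (gaussianReal 0 1) :=
    (integrable_const _).add (hsq.const_mul r)
  rw [integral_add hlin
      (integrable_sq_max_neg_gaussianReal.const_mul _),
    integral_add (integrable_const _) (hsq.const_mul r), integral_const_mul, integral_const_mul,
    integral_add (integrable_const _) integrable_sq_gaussianReal,
    integral_sq_max_neg_gaussianReal, integral_sq_gaussianReal] at h
  simp only [integral_const, probReal_univ, smul_eq_mul] at h
  linarith

/-- At signal strength `κ = 0`, the separability phase-transition threshold
`δ*(0) = inf_{r > 0} r⁻² ∫ ((1 - r z)₊)² dγ(z)` equals `1/2`, where `γ` is the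
standard Gaussian measure on `ℝ`. -/
theorem delta_star_at_zero :
    sInf {x : ℝ | ∃ r : ℝ, 0 < r ∧
      x = (r ^ 2)⁻¹ * ∫ z, (max (1 - r * z) 0) ^ 2 ∂(gaussianReal 0 1)} = 1 / 2 := by
  refine csInf_eq_of_forall_ge_of_forall_gt_exists_lt ⟨_, 1, one_pos, rfl⟩ ?_ ?_
  · rintro x ⟨r, hr, rfl⟩
    rw [← div_eq_inv_mul, le_div_iff₀ (by positivity)]
    linarith [le_integral_sq_max_one_sub_mul_gaussianReal hr]
  · intro w hw
    have he : 0 < w - 1 / 2 := by linarith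
    set r : ℝ := 1 + 3 / (w - 1 / 2) with hrdef
    have hr1 : 1 < r := by
      have : 0 < 3 / (w - 1 / 2) := by positivity
      linarith
    have hr : 0 < r := by linarith
    refine ⟨_, ⟨r, hr, rfl⟩, ?_⟩
    rw [← div_eq_inv_mul, div_lt_iff₀ (by positivity)]
    have hmul : (w - 1 / 2) * r = (w - 1 / 2) + 3 := by
      rw [hrdef, mul_add, mul_one, mul_div_cancel₀ _ he.ne']
    nlinarith [integral_sq_max_one_sub_mul_gaussianReal_le hr]
end

section
/- Let ρ(t) = 1/(1 + e^{−t}) be the standard logistic link function, and for κ ≥ 0 define c_κ(s,r) = ∫∫ [ρ(κz₁)·((1 − κ·s·z₁ − r·z₂)₊)² + (1 − ρ(κz₁))·((1 + κ·s·z₁ − r·z₂)₊)²] dγ(z₁) dγ(z₂), where γ is the standard Gaussian measure on ℝ. Define δ*(κ) = inf_{s ∈ ℝ, r > 0} c_κ(s,r)/r². Then the function κ ↦ δ*(κ) is nonincreasing on [0, ∞). -/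
open MeasureTheory ProbabilityTheory

/-- The standard logistic link function `ρ(t) = 1/(1 + e^{-t})`. -/
noncomputable def logisticLink (t : ℝ) : ℝ := 1 / (1 + Real.exp (-t))

/-- The summary functional
`c_κ(s,r) = E[((1 - κ s Z₁ Y - r Z₂)₊)²]`, written out by conditioning on the
label `Y ∈ {±1}` with `P(Y = 1 | Z₁) = ρ(κ Z₁)`, where `Z₁, Z₂` are i.i.d.
standard Gaussians. -/
noncomputable def summaryFunctional (κ s r : ℝ) : ℝ :=
  ∫ z₁, ∫ z₂,
    (logisticLink (κ * z₁) * (max (1 - κ * s * z₁ - r * z₂) 0) ^ 2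
      + (1 - logisticLink (κ * z₁)) * (max (1 + κ * s * z₁ - r * z₂) 0) ^ 2)
    ∂(gaussianReal 0 1) ∂(gaussianReal 0 1)

/-- The phase-transition threshold `δ*(κ) = inf_{s ∈ ℝ, r > 0} c_κ(s,r)/r²`. -/
noncomputable def deltaStar (κ : ℝ) : ℝ :=
  sInf {x : ℝ | ∃ s : ℝ, ∃ r : ℝ, 0 < r ∧ x = summaryFunctional κ s r / r ^ 2}

lemma logisticLink_nonneg (t : ℝ) : 0 ≤ logisticLink t := by
  unfold logisticLink; positivity

lemma logisticLink_mono : Monotone logisticLink := by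
  intro a b h
  unfold logisticLink
  gcongr

lemma logisticLink_neg (t : ℝ) : logisticLink (-t) = 1 - logisticLink t := by
  unfold logisticLink
  have h : Real.exp t * Real.exp (-t) = 1 := by rw [← Real.exp_add]; simp
  rw [neg_neg]
  field_simp
  linear_combination -h

lemma logisticLink_le_one (t : ℝ) : logisticLink t ≤ 1 := by
  linarith [logisticLink_nonneg (-t), logisticLink_neg t]

lemma continuous_logisticLink : Continuous logisticLink := by
  unfold logisticLink
  refine continuous_const.div (by fun_prop) fun t => ?_
  positivity

/-- The integrand of `summaryFunctional`, with the product `κ s` replaced by a free slope `u`. -/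
noncomputable def summaryIntegrand (κ u r z₁ z₂ : ℝ) : ℝ :=
  logisticLink (κ * z₁) * (max (1 - u * z₁ - r * z₂) 0) ^ 2
    + (1 - logisticLink (κ * z₁)) * (max (1 + u * z₁ - r * z₂) 0) ^ 2

lemma summaryFunctional_eq (κ s r : ℝ) : summaryFunctional κ s r =
    ∫ z₁, ∫ z₂, summaryIntegrand κ (κ * s) r z₁ z₂ ∂(gaussianReal 0 1) ∂(gaussianReal 0 1) :=
  rfl

lemma summaryIntegrand_nonneg (κ u r z₁ z₂ : ℝ) : 0 ≤ summaryIntegrand κ u r z₁ z₂ :=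
  add_nonneg (mul_nonneg (logisticLink_nonneg _) (sq_nonneg _))
    (mul_nonneg (sub_nonneg.2 (logisticLink_le_one _)) (sq_nonneg _))

lemma summaryFunctional_nonneg (κ s r : ℝ) : 0 ≤ summaryFunctional κ s r :=
  integral_nonneg fun _ => integral_nonneg fun _ => summaryIntegrand_nonneg _ _ _ _ _

lemma summaryIntegrand_neg (κ u r z₁ z₂ : ℝ) :
    summaryIntegrand κ u r (-z₁) z₂ = summaryIntegrand κ u r z₁ z₂ := by
  simp only [summaryIntegrand, mul_neg, logisticLink_neg, sub_neg_eq_add, ← sub_eq_add_neg]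
  ring

/-- A stronger signal together with a nonnegative slope decreases the integrand pointwise. -/
lemma summaryIntegrand_abs_le {κ₁ κ₂ : ℝ} (h₁ : 0 ≤ κ₁) (h : κ₁ ≤ κ₂) (u r z₁ z₂ : ℝ) :
    summaryIntegrand κ₂ |u| r z₁ z₂ ≤ summaryIntegrand κ₁ u r z₁ z₂ := by
  wlog hz : 0 ≤ z₁ generalizing z₁
  · rw [← summaryIntegrand_neg κ₂, ← summaryIntegrand_neg κ₁]
    exact this (-z₁) (by linarith)
  have hρ : logisticLink (κ₁ * z₁) ≤ logisticLink (κ₂ * z₁) :=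
    logisticLink_mono (by gcongr)
  have hhalf : 1 - logisticLink (κ₁ * z₁) ≤ logisticLink (κ₁ * z₁) := by
    rw [← logisticLink_neg]
    exact logisticLink_mono (by nlinarith [mul_nonneg h₁ hz])
  have hG : (max (1 - |u| * z₁ - r * z₂) 0) ^ 2 ≤ (max (1 + |u| * z₁ - r * z₂) 0) ^ 2 := by
    have := mul_nonneg (abs_nonneg u) hz
    gcongr
    linarith
  unfold summaryIntegrand
  rcases abs_cases u with ⟨hu, -⟩ | ⟨hu, -⟩
  · rw [hu] at hG ⊢
    nlinarith
  · rw [hu] at hG ⊢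
    simp only [neg_mul, sub_neg_eq_add, ← sub_eq_add_neg] at hG ⊢
    nlinarith

lemma integrable_summaryIntegrand (κ u r : ℝ) :
    Integrable (fun p : ℝ × ℝ => summaryIntegrand κ u r p.1 p.2)
      ((gaussianReal 0 1).prod (gaussianReal 0 1)) := by
  have hsq : Integrable (fun z : ℝ => z ^ 2) (gaussianReal 0 1) :=
    (memLp_id_gaussianReal 2).integrable_sq
  have hbound : Integrable (fun p : ℝ × ℝ => 3 * (1 + u ^ 2 * p.1 ^ 2 + r ^ 2 * p.2 ^ 2))
      ((gaussianReal 0 1).prod (gaussianReal 0 1)) :=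
    (((integrable_const 1).add ((hsq.comp_fst _).const_mul (u ^ 2))).add
      ((hsq.comp_snd _).const_mul (r ^ 2))).const_mul 3
  refine hbound.mono' ?_ (.of_forall fun p => ?_)
  · have := continuous_logisticLink
    unfold summaryIntegrand
    exact Continuous.aestronglyMeasurable (by fun_prop)
  · rw [Real.norm_of_nonneg (summaryIntegrand_nonneg _ _ _ _ _)]
    have hmax (a : ℝ) : (max a 0) ^ 2 ≤ a ^ 2 := by
      rcases max_cases a 0 with ⟨ha, -⟩ | ⟨ha, -⟩ <;> rw [ha]
      nlinarith
    have hminus := (hmax (1 - u * p.1 - r * p.2)).trans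
      (show _ ≤ 3 * (1 + u ^ 2 * p.1 ^ 2 + r ^ 2 * p.2 ^ 2) by
        nlinarith [sq_nonneg (1 + u * p.1), sq_nonneg (1 + r * p.2), sq_nonneg (u * p.1 - r * p.2)])
    have hplus := (hmax (1 + u * p.1 - r * p.2)).trans
      (show _ ≤ 3 * (1 + u ^ 2 * p.1 ^ 2 + r ^ 2 * p.2 ^ 2) by
        nlinarith [sq_nonneg (1 - u * p.1), sq_nonneg (1 + r * p.2), sq_nonneg (u * p.1 + r * p.2)])
    have h₀ := mul_le_mul_of_nonneg_left hminus (logisticLink_nonneg (κ * p.1))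
    have h₁ := mul_le_mul_of_nonneg_left hplus (sub_nonneg.2 (logisticLink_le_one (κ * p.1)))
    unfold summaryIntegrand
    linarith

lemma exists_summaryFunctional_le {κ₁ κ₂ : ℝ} (h₁ : 0 ≤ κ₁) (h : κ₁ ≤ κ₂) (s r : ℝ) :
    ∃ s', summaryFunctional κ₂ s' r ≤ summaryFunctional κ₁ s r := by
  obtain ⟨s', hs'⟩ : ∃ s', κ₂ * s' = |κ₁ * s| := by
    rcases (h₁.trans h).eq_or_lt with h₂ | h₂
    · have : κ₁ = 0 := by linarith
      exact ⟨0, by simp [this]⟩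
    · exact ⟨|κ₁ * s| / κ₂, mul_div_cancel₀ _ h₂.ne'⟩
  refine ⟨s', ?_⟩
  rw [summaryFunctional_eq, summaryFunctional_eq, hs']
  have hint₂ := integrable_summaryIntegrand κ₂ |κ₁ * s| r
  have hint₁ := integrable_summaryIntegrand κ₁ (κ₁ * s) r
  refine integral_mono_ae hint₂.integral_prod_left hint₁.integral_prod_left ?_
  filter_upwards [hint₂.prod_right_ae, hint₁.prod_right_ae] with z₁ hz₂ hz₁
  exact integral_mono hz₂ hz₁ fun z₂ => summaryIntegrand_abs_le h₁ h _ _ _ _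

/-- The separability phase-transition threshold `κ ↦ δ*(κ)` is nonincreasing on `[0, ∞)`. -/
theorem deltaStar_antitoneOn : AntitoneOn deltaStar (Set.Ici 0) := by
  intro κ₁ h₁ κ₂ h₂ h
  refine le_csInf ⟨_, 0, 1, one_pos, rfl⟩ ?_
  rintro x ⟨s, r, hr, rfl⟩
  obtain ⟨s', hs'⟩ := exists_summaryFunctional_le h₁ h s r
  calc deltaStar κ₂ ≤ summaryFunctional κ₂ s' r / r ^ 2 := by
        refine csInf_le ⟨0, ?_⟩ ⟨s', r, hr, rfl⟩
        rintro y ⟨t, q, -, rfl⟩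
        exact div_nonneg (summaryFunctional_nonneg κ₂ t q) (sq_nonneg q)
    _ ≤ summaryFunctional κ₁ s r / r ^ 2 := by gcongr
end

section
/- Let ρ(t) = 1/(1 + e^{−t}) be the standard logistic link function, and for κ ≥ 0 define c_κ(s,r) = ∫∫ [ρ(κz₁)·((1 − κ·s·z₁ − r·z₂)₊)² + (1 − ρ(κz₁))·((1 + κ·s·z₁ − r·z₂)₊)²] dγ(z₁) dγ(z₂), where γ is the standard Gaussian measure on ℝ, and define δ*(κ) = inf_{s ∈ ℝ, r > 0} c_κ(s,r)/r². Then δ*(κ) → 0 as κ → ∞. -/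
open MeasureTheory ProbabilityTheory

lemma logisticLink_pos (t : ℝ) : 0 < logisticLink t := by
  unfold logisticLink; positivity

lemma logisticLink_le_exp (t : ℝ) : logisticLink t ≤ Real.exp t := by
  unfold logisticLink
  rw [div_le_iff₀ (by positivity), mul_add, ← Real.exp_add]
  simp [Real.exp_nonneg]

lemma one_sub_logisticLink (t : ℝ) : 1 - logisticLink t = logisticLink (-t) := by
  unfold logisticLink
  rw [neg_neg, Real.exp_neg]
  have := Real.exp_pos t
  field_simp
  ring

lemma measurable_logisticLink : Measurable logisticLink := by
  unfold logisticLink; fun_prop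

/-- The contribution of the label `Y = 1` to the integrand of `summaryFunctional κ s 1` along the
curve `κ s = √κ`. -/
noncomputable def labelTerm (κ z w : ℝ) : ℝ :=
  logisticLink (κ * z) * (max (1 - √κ * z - w) 0) ^ 2

lemma labelTerm_nonneg (κ z w : ℝ) : 0 ≤ labelTerm κ z w :=
  mul_nonneg (logisticLink_pos _).le (sq_nonneg _)

lemma measurable_labelTerm (κ : ℝ) : Measurable fun p : ℝ × ℝ => labelTerm κ p.1 p.2 := by
  unfold labelTerm
  have := measurable_logisticLink
  fun_prop

lemma labelTerm_le_of_nonpos {κ z : ℝ} (hκ : 0 ≤ κ) (hz : z ≤ 0) (w : ℝ) :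
    labelTerm κ z w ≤ logisticLink (κ * z) * (2 * (κ * z ^ 2) + 2 * (1 + |w|) ^ 2) := by
  refine mul_le_mul_of_nonneg_left ?_ (logisticLink_pos _).le
  have hs : 0 ≤ √κ * -z := mul_nonneg (Real.sqrt_nonneg _) (by linarith)
  have hmax : max (1 - √κ * z - w) 0 ≤ √κ * -z + (1 + |w|) :=
    max_le (by linarith [neg_abs_le w]) (by positivity)
  calc (max (1 - √κ * z - w) 0) ^ 2 ≤ (√κ * -z + (1 + |w|)) ^ 2 :=
        pow_le_pow_left₀ (le_max_right _ _) hmax 2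
    _ ≤ 2 * (√κ * -z) ^ 2 + 2 * (1 + |w|) ^ 2 := by
        nlinarith [sq_nonneg (√κ * -z - (1 + |w|))]
    _ = 2 * (κ * z ^ 2) + 2 * (1 + |w|) ^ 2 := by
        rw [mul_pow, Real.sq_sqrt hκ, neg_sq]

lemma labelTerm_le {κ : ℝ} (hκ : 0 ≤ κ) (z w : ℝ) :
    labelTerm κ z w ≤ 2 * |z| + 2 * (1 + |w|) ^ 2 := by
  have h1 := logisticLink_le_one (κ * z)
  have h0 := logisticLink_pos (κ * z)
  rcases le_total z 0 with hz | hz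
  · refine (labelTerm_le_of_nonpos hκ hz w).trans ?_
    have hexp : logisticLink (κ * z) * (κ * |z|) ≤ 1 := by
      calc logisticLink (κ * z) * (κ * |z|)
          ≤ Real.exp (κ * z) * Real.exp (κ * |z|) := by
            refine mul_le_mul (logisticLink_le_exp _) ?_ (by positivity) (Real.exp_nonneg _)
            linarith [Real.add_one_le_exp (κ * |z|)]
        _ = 1 := by rw [← Real.exp_add, abs_of_nonpos hz]; simp
    have hsq : z ^ 2 = |z| * |z| := by rw [← sq, sq_abs]
    have hz1 := mul_le_mul_of_nonneg_right hexp (abs_nonneg z)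
    have hw1 := mul_le_mul_of_nonneg_right h1 (sq_nonneg (1 + |w|))
    rw [hsq]
    linarith
  · have hmax : max (1 - √κ * z - w) 0 ≤ 1 + |w| :=
      max_le (by linarith [neg_abs_le w, mul_nonneg (Real.sqrt_nonneg κ) hz]) (by positivity)
    have hsq := pow_le_pow_left₀ (le_max_right _ _) hmax 2
    have := mul_le_mul h1 hsq (sq_nonneg _) zero_le_one
    unfold labelTerm
    linarith [abs_nonneg z, sq_nonneg (1 + |w|)]

lemma tendsto_labelTerm {z : ℝ} (hz : z ≠ 0) (w : ℝ) :
    Filter.Tendsto (fun κ => labelTerm κ z w) Filter.atTop (nhds 0) := by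
  rcases hz.lt_or_gt with hz | hz
  · have hlin : Filter.Tendsto (fun κ : ℝ => κ * -z) Filter.atTop Filter.atTop :=
      Filter.tendsto_id.atTop_mul_const (by linarith)
    have h1 := (Real.tendsto_pow_mul_exp_neg_atTop_nhds_zero 1).comp hlin
    have h0 := (Real.tendsto_pow_mul_exp_neg_atTop_nhds_zero 0).comp hlin
    have hlim := (h1.const_mul (2 * -z)).add (h0.const_mul (2 * (1 + |w|) ^ 2))
    rw [mul_zero, mul_zero, add_zero] at hlim
    refine squeeze_zero' (.of_forall fun κ => labelTerm_nonneg κ z w) ?_ hlim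
    filter_upwards [Filter.eventually_ge_atTop 0] with κ hκ
    calc labelTerm κ z w
        ≤ logisticLink (κ * z) * (2 * (κ * z ^ 2) + 2 * (1 + |w|) ^ 2) :=
          labelTerm_le_of_nonpos hκ hz.le w
      _ ≤ Real.exp (κ * z) * (2 * (κ * z ^ 2) + 2 * (1 + |w|) ^ 2) :=
          mul_le_mul_of_nonneg_right (logisticLink_le_exp _) (by positivity)
      _ = _ := by
          simp only [Function.comp_apply, mul_neg, neg_neg]
          ring
  · have hlin : Filter.Tendsto (fun κ : ℝ => √κ * z) Filter.atTop Filter.atTop :=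
      Real.tendsto_sqrt_atTop.atTop_mul_const hz
    refine tendsto_const_nhds.congr' ?_
    filter_upwards [hlin.eventually_ge_atTop (1 - w)] with κ hκ
    unfold labelTerm
    rw [max_eq_right (by linarith)]
    simp

/-- A `κ`-uniform integrable majorant of the integrand. -/
lemma integrable_majorant :
    Integrable (fun p : ℝ × ℝ => 4 * |p.1| + 4 * (1 + |p.2|) ^ 2)
      ((gaussianReal 0 1).prod (gaussianReal 0 1)) := by
  have hid (p : ENNReal) (hp : p ≠ ⊤) : MemLp (fun z : ℝ => z) p (gaussianReal 0 1) :=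
    memLp_id_gaussianReal' p hp
  have h1 : Integrable (fun z : ℝ => 4 * |z|) (gaussianReal 0 1) :=
    ((hid 1 (by simp)).integrable le_rfl).abs.const_mul 4
  have h2 : MemLp (fun w : ℝ => 1 + |w|) 2 (gaussianReal 0 1) :=
    (memLp_const (1 : ℝ)).add (hid 2 (by simp)).abs
  have h3 : Integrable (fun w : ℝ => 4 * (1 + |w|) ^ 2) (gaussianReal 0 1) :=
    h2.integrable_sq.const_mul 4
  exact (h1.comp_fst (gaussianReal 0 1)).add (h3.comp_snd (gaussianReal 0 1))

lemma norm_labelTerm_add_le {κ : ℝ} (hκ : 0 ≤ κ) (z w : ℝ) :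
    ‖labelTerm κ z w + labelTerm κ (-z) w‖ ≤ 4 * |z| + 4 * (1 + |w|) ^ 2 := by
  rw [Real.norm_of_nonneg (add_nonneg (labelTerm_nonneg _ _ _) (labelTerm_nonneg _ _ _))]
  have h1 := labelTerm_le hκ z w
  have h2 := labelTerm_le hκ (-z) w
  rw [abs_neg] at h2
  linarith

lemma measurable_labelTerm_add (κ : ℝ) :
    Measurable fun p : ℝ × ℝ => labelTerm κ p.1 p.2 + labelTerm κ (-p.1) p.2 :=
  (measurable_labelTerm κ).add
    ((measurable_labelTerm κ).comp (measurable_fst.neg.prodMk measurable_snd))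

lemma summaryFunctional_sqrt_div {κ : ℝ} (hκ : 0 < κ) :
    summaryFunctional κ (√κ / κ) 1 =
      ∫ p, (labelTerm κ p.1 p.2 + labelTerm κ (-p.1) p.2)
        ∂(gaussianReal 0 1).prod (gaussianReal 0 1) := by
  have hint : Integrable (fun p : ℝ × ℝ => labelTerm κ p.1 p.2 + labelTerm κ (-p.1) p.2)
      ((gaussianReal 0 1).prod (gaussianReal 0 1)) :=
    integrable_majorant.mono' (measurable_labelTerm_add κ).aestronglyMeasurable
      (.of_forall fun p => norm_labelTerm_add_le hκ.le p.1 p.2)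
  rw [integral_prod _ hint]
  simp only [summaryFunctional, labelTerm, mul_div_cancel₀ _ hκ.ne', one_sub_logisticLink,
    mul_neg, sub_neg_eq_add, one_mul]

lemma tendsto_summaryFunctional_sqrt_div :
    Filter.Tendsto (fun κ => summaryFunctional κ (√κ / κ) 1) Filter.atTop (nhds 0) := by
  have hne : ∀ᵐ p ∂(gaussianReal 0 1).prod (gaussianReal 0 1), p.1 ≠ 0 := by
    have := nullSingletonClass_gaussianReal (μ := 0) (v := 1) one_ne_zero
    have h0 : ∀ᵐ z ∂gaussianReal 0 1, z ≠ 0 := Measure.ae_ne (gaussianReal 0 1) 0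
    exact Measure.quasiMeasurePreserving_fst.ae h0
  have hlim := tendsto_integral_filter_of_dominated_convergence (l := Filter.atTop)
    (F := fun κ (p : ℝ × ℝ) => labelTerm κ p.1 p.2 + labelTerm κ (-p.1) p.2) (f := fun _ => (0 : ℝ))
    (fun p : ℝ × ℝ => 4 * |p.1| + 4 * (1 + |p.2|) ^ 2)
    (.of_forall fun κ => (measurable_labelTerm_add κ).aestronglyMeasurable)
    ((Filter.eventually_ge_atTop 0).mono fun κ hκ =>
      .of_forall fun p => norm_labelTerm_add_le hκ p.1 p.2)
    integrable_majorant
    (hne.mono fun p hp => by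
      simpa using (tendsto_labelTerm hp p.2).add (tendsto_labelTerm (neg_ne_zero.2 hp) p.2))
  rw [integral_zero] at hlim
  refine hlim.congr' ?_
  filter_upwards [Filter.eventually_gt_atTop 0] with κ hκ
  exact (summaryFunctional_sqrt_div hκ).symm

lemma deltaStar_nonneg (κ : ℝ) : 0 ≤ deltaStar κ := by
  refine Real.sInf_nonneg ?_
  rintro x ⟨s, r, -, rfl⟩
  exact div_nonneg (summaryFunctional_nonneg _ _ _) (sq_nonneg _)

lemma deltaStar_le (κ s : ℝ) {r : ℝ} (hr : 0 < r) :
    deltaStar κ ≤ summaryFunctional κ s r / r ^ 2 := by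
  refine csInf_le ⟨0, ?_⟩ ⟨s, r, hr, rfl⟩
  rintro x ⟨s, r, -, rfl⟩
  exact div_nonneg (summaryFunctional_nonneg _ _ _) (sq_nonneg _)

/-- The separability phase-transition threshold satisfies `δ*(κ) → 0` as `κ → ∞`. -/
theorem deltaStar_tendsto_zero :
    Filter.Tendsto deltaStar Filter.atTop (nhds 0) := by
  refine squeeze_zero deltaStar_nonneg (fun κ => ?_) tendsto_summaryFunctional_sqrt_div
  simpa using deltaStar_le κ (√κ / κ) one_pos
end

section
/- Let μ be the standard Gaussian measure on ℝ^p (the product over i ∈ {1,…,p} of the Gaussian measure on ℝ with mean 0 and variance 1), and let u, v ∈ ℝ^p be nonzero vectors. Then μ{ x ∈ ℝ^p : sign(⟨x,u⟩) ≠ sign(⟨x,v⟩) } = (1/π)·arccos( ⟨u,v⟩ / (‖u‖·‖v‖) ), where ⟨·,·⟩ and ‖·‖ are the Euclidean inner product and norm. -/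
open MeasureTheory ProbabilityTheory
open scoped Real ENNReal

lemma charFunDual_gaussianReal_zero_one (L : StrongDual ℝ ℝ) :
    charFunDual (gaussianReal 0 1) L = Complex.exp (-((L 1 ^ 2 : ℝ) : ℂ) / 2) := by
  have hL : ∀ x, L x = L 1 * x := fun x => by
    simpa [mul_comm] using L.map_smul x 1
  have h := charFun_gaussianReal (μ := 0) (v := 1) (L 1)
  rw [charFun_apply_real] at h
  rw [charFunDual_apply]
  calc _ = ∫ x, Complex.exp (L 1 * x * Complex.I) ∂gaussianReal 0 1 := by
        refine integral_congr_ae (.of_forall fun x => ?_)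
        simp only
        rw [hL x, Complex.ofReal_mul]
    _ = _ := h.trans ?_
  congr 1
  push_cast
  ring

lemma charFunDual_pi_gaussianReal {p : ℕ} (L : StrongDual ℝ (Fin p → ℝ)) :
    charFunDual (Measure.pi fun _ : Fin p => gaussianReal 0 1) L =
      Complex.exp (-((∑ i, L (Pi.single i 1) ^ 2 : ℝ) : ℂ) / 2) := by
  rw [charFunDual_pi]
  simp_rw [charFunDual_gaussianReal_zero_one]
  rw [← Complex.exp_sum, ← Finset.sum_div, Finset.sum_neg_distrib]
  simp

lemma charFunDual_prod_gaussianReal (L : StrongDual ℝ (ℝ × ℝ)) :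
    charFunDual ((gaussianReal 0 1).prod (gaussianReal 0 1)) L =
      Complex.exp (-((L (1, 0) ^ 2 + L (0, 1) ^ 2 : ℝ) : ℂ) / 2) := by
  rw [charFunDual_prod]
  simp_rw [charFunDual_gaussianReal_zero_one]
  rw [← Complex.exp_add]
  congr 1
  simp
  ring

/-- The joint law of two linear functionals of a standard Gaussian vector depends only on the
Gram matrix of the functionals. -/
lemma map_pi_gaussianReal_eq_map_prod {p : ℕ} (u v : Fin p → ℝ) (a b : ℝ × ℝ)
    (huu : ∑ i, u i ^ 2 = a.1 ^ 2 + a.2 ^ 2) (hvv : ∑ i, v i ^ 2 = b.1 ^ 2 + b.2 ^ 2)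
    (huv : ∑ i, u i * v i = a.1 * b.1 + a.2 * b.2) :
    (Measure.pi fun _ : Fin p => gaussianReal 0 1).map
        (fun x => (∑ i, x i * u i, ∑ i, x i * v i)) =
      ((gaussianReal 0 1).prod (gaussianReal 0 1)).map
        (fun z => (z.1 * a.1 + z.2 * a.2, z.1 * b.1 + z.2 * b.2)) := by
  let S : (Fin p → ℝ) →L[ℝ] ℝ × ℝ :=
    (∑ i, (ContinuousLinearMap.proj (R := ℝ) i).smulRight (u i)).prod
      (∑ i, (ContinuousLinearMap.proj (R := ℝ) i).smulRight (v i))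
  let T : ℝ × ℝ →L[ℝ] ℝ × ℝ :=
    ((ContinuousLinearMap.fst ℝ ℝ ℝ).smulRight a.1 +
      (ContinuousLinearMap.snd ℝ ℝ ℝ).smulRight a.2).prod
    ((ContinuousLinearMap.fst ℝ ℝ ℝ).smulRight b.1 +
      (ContinuousLinearMap.snd ℝ ℝ ℝ).smulRight b.2)
  have hS : (fun x : Fin p → ℝ => (∑ i, x i * u i, ∑ i, x i * v i)) = S := by
    ext x <;> simp [S]
  have hT : (fun z : ℝ × ℝ => (z.1 * a.1 + z.2 * a.2, z.1 * b.1 + z.2 * b.2)) = T := by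
    ext x <;> simp [T]
  have hSi : ∀ i, S (Pi.single i 1) = (u i, v i) := fun i => by
    simp [← hS, Pi.single_apply]
  have hTe : T (1, 0) = (a.1, b.1) ∧ T (0, 1) = (a.2, b.2) := by simp [← hT]
  rw [hS, hT]
  refine Measure.ext_of_charFunDual ?_
  ext L
  have hL : ∀ s t, L (s, t) = s * L (1, 0) + t * L (0, 1) := fun s t => by
    rw [← smul_eq_mul, ← smul_eq_mul, ← L.map_smul, ← L.map_smul, ← L.map_add]
    simp
  rw [charFunDual_map, charFunDual_map, charFunDual_pi_gaussianReal,
    charFunDual_prod_gaussianReal]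
  simp only [ContinuousLinearMap.comp_apply, hSi, hTe.1, hTe.2]
  have key : ∑ i, L (u i, v i) ^ 2 = L (a.1, b.1) ^ 2 + L (a.2, b.2) ^ 2 := by
    calc ∑ i, L (u i, v i) ^ 2
        = L (1, 0) ^ 2 * ∑ i, u i ^ 2 + 2 * L (1, 0) * L (0, 1) * ∑ i, u i * v i +
            L (0, 1) ^ 2 * ∑ i, v i ^ 2 := by
          simp_rw [Finset.mul_sum, ← Finset.sum_add_distrib]
          refine Finset.sum_congr rfl fun i _ => ?_
          rw [hL (u i)]
          ring
      _ = _ := by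
          rw [huu, hvv, huv, hL a.1, hL a.2]
          ring
  rw [key]

lemma prod_gaussianReal_eq_withDensity :
    (gaussianReal 0 1).prod (gaussianReal 0 1) =
      (volume : Measure (ℝ × ℝ)).withDensity
        fun z => ENNReal.ofReal ((2 * π)⁻¹ * Real.exp (-(z.1 ^ 2 + z.2 ^ 2) / 2)) := by
  rw [gaussianReal_of_var_ne_zero 0 one_ne_zero,
    prod_withDensity (measurable_gaussianPDF 0 1) (measurable_gaussianPDF 0 1)]
  congr 1
  ext z
  rw [gaussianPDF, gaussianPDF, ← ENNReal.ofReal_mul (gaussianPDFReal_nonneg _ _ _)]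
  congr 1
  simp only [gaussianPDFReal, NNReal.coe_one, mul_one, sub_zero]
  rw [mul_mul_mul_comm, ← Real.exp_add, ← mul_inv, Real.mul_self_sqrt (by positivity)]
  congr 2
  ring

/-- The planar standard Gaussian measure of a cone is proportional to its opening. -/
lemma prod_gaussianReal_cone {A : Set (ℝ × ℝ)} {B : Set ℝ} (hA : MeasurableSet A)
    (hB : MeasurableSet B)
    (hAB : ∀ r > 0, ∀ φ ∈ Set.Ioo (-π) π, (r * Real.cos φ, r * Real.sin φ) ∈ A ↔ φ ∈ B) :
    (gaussianReal 0 1).prod (gaussianReal 0 1) A =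
      volume (B ∩ Set.Ioo (-π) π) / ENNReal.ofReal (2 * π) := by
  obtain ⟨C, hC⟩ : ∃ C : ℝ≥0∞, ∀ (A : Set (ℝ × ℝ)) (B : Set ℝ), MeasurableSet A →
      MeasurableSet B →
      (∀ r > 0, ∀ φ ∈ Set.Ioo (-π) π, (r * Real.cos φ, r * Real.sin φ) ∈ A ↔ φ ∈ B) →
      (gaussianReal 0 1).prod (gaussianReal 0 1) A = C * volume (B ∩ Set.Ioo (-π) π) := by
    let g : ℝ → ℝ≥0∞ := fun r =>
      ENNReal.ofReal r * ENNReal.ofReal ((2 * π)⁻¹ * Real.exp (-r ^ 2 / 2))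
    have hg : Measurable g := by fun_prop
    refine ⟨∫⁻ r in Set.Ioi 0, g r, fun A B hA hB hAB => ?_⟩
    rw [prod_gaussianReal_eq_withDensity, withDensity_apply _ hA, ← lintegral_indicator hA,
      ← lintegral_comp_polarCoord_symm, polarCoord_target]
    calc _ = ∫⁻ z in Set.Ioi (0 : ℝ) ×ˢ Set.Ioo (-π) π, g z.1 * B.indicator 1 z.2 := by
          refine setLIntegral_congr_fun (measurableSet_Ioi.prod measurableSet_Ioo) ?_
          rintro ⟨r, φ⟩ ⟨hr, hφ⟩
          have hrφ : (r * Real.cos φ) ^ 2 + (r * Real.sin φ) ^ 2 = r ^ 2 := by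
            linear_combination r ^ 2 * Real.sin_sq_add_cos_sq φ
          by_cases h : φ ∈ B
          · simp only [polarCoord_symm_apply, Set.indicator_of_mem h,
              Set.indicator_of_mem ((hAB r hr φ hφ).2 h), g, hrφ, smul_eq_mul, Pi.one_apply,
              mul_one]
          · simp [polarCoord_symm_apply, h, mt (hAB r hr φ hφ).1 h]
      _ = _ := by
          rw [Measure.volume_eq_prod, ← Measure.prod_restrict,
            lintegral_prod_mul hg.aemeasurable (measurable_one.indicator hB).aemeasurable,
            lintegral_indicator_one hB, Measure.restrict_apply hB]
  have h1 := hC Set.univ Set.univ .univ .univ (by simp)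
  rw [measure_univ, Set.univ_inter, Real.volume_Ioo, sub_neg_eq_add, ← two_mul] at h1
  rw [hC A B hA hB hAB, ENNReal.eq_inv_of_mul_eq_one_left h1.symm, mul_comm, div_eq_mul_inv]

lemma volume_sign_sin_ne_sign_sin_sub {θ : ℝ} (h0 : 0 ≤ θ) (hπ : θ ≤ π) :
    volume ({φ | Real.sign (Real.sin φ) ≠ Real.sign (Real.sin (φ - θ))} ∩ Set.Ioo (-π) π) =
      ENNReal.ofReal (2 * θ) := by
  have hsum : ENNReal.ofReal (2 * θ) = ENNReal.ofReal (θ - 0) + ENNReal.ofReal (θ - π - -π) := by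
    rw [← ENNReal.ofReal_add (by linarith) (by linarith)]
    congr 1
    ring
  have hpos : ∀ x, Real.sin x > 0 → Real.sign (Real.sin x) = 1 := fun _ => Real.sign_of_pos
  have hneg : ∀ x, Real.sin x < 0 → Real.sign (Real.sin x) = -1 := fun _ => Real.sign_of_neg
  apply le_antisymm
  · calc _ ≤ volume (Set.Icc 0 θ ∪ Set.Icc (-π) (θ - π)) := by
          refine measure_mono ?_
          rintro φ ⟨hφ, h1, h2⟩
          by_contra h
          simp only [Set.mem_union, Set.mem_Icc, not_or, not_and, not_le] at h
          refine hφ ?_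
          rcases le_or_gt 0 φ with h3 | h3
          · have := h.1 h3
            rw [hpos _ (Real.sin_pos_of_pos_of_lt_pi (by linarith) h2),
              hpos _ (Real.sin_pos_of_pos_of_lt_pi (by linarith) (by linarith))]
          · have := h.2 h1.le
            rw [hneg _ (Real.sin_neg_of_neg_of_neg_pi_lt h3 h1),
              hneg _ (Real.sin_neg_of_neg_of_neg_pi_lt (by linarith) (by linarith))]
      _ ≤ _ := by
          refine (measure_union_le _ _).trans_eq ?_
          rw [Real.volume_Icc, Real.volume_Icc, hsum]
  · calc ENNReal.ofReal (2 * θ) = volume (Set.Ioo 0 θ ∪ Set.Ioo (-π) (θ - π)) := by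
          rw [measure_union _ measurableSet_Ioo, Real.volume_Ioo, Real.volume_Ioo, hsum]
          refine Set.disjoint_left.2 fun x hx hx' => ?_
          linarith [hx.1, hx'.2]
      _ ≤ _ := by
          refine measure_mono ?_
          rintro φ (⟨h1, h2⟩ | ⟨h1, h2⟩)
          · refine ⟨?_, by linarith, by linarith⟩
            rw [Set.mem_ofPred_eq, hpos _ (Real.sin_pos_of_pos_of_lt_pi h1 (by linarith)),
              hneg _ (Real.sin_neg_of_neg_of_neg_pi_lt (by linarith) (by linarith))]
            norm_num
          · refine ⟨?_, by linarith, by linarith⟩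
            rw [Set.mem_ofPred_eq, hneg _ (Real.sin_neg_of_neg_of_neg_pi_lt (by linarith) h1),
              ← Real.sin_add_two_pi,
              hpos _ (Real.sin_pos_of_pos_of_lt_pi (by linarith) (by linarith))]
            norm_num

lemma measurable_real_sign : Measurable Real.sign :=
  Measurable.ite measurableSet_Iio measurable_const
    (Measurable.ite measurableSet_Ioi measurable_const measurable_const)

lemma real_sign_mul_of_pos {c : ℝ} (hc : 0 < c) (x : ℝ) : Real.sign (c * x) = Real.sign x := by
  rcases lt_trichotomy x 0 with h | rfl | h
  · rw [Real.sign_of_neg h, Real.sign_of_neg (mul_neg_of_pos_of_neg hc h)]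
  · simp
  · rw [Real.sign_of_pos h, Real.sign_of_pos (mul_pos hc h)]

/-- Under the standard Gaussian measure on `ℝ^p`, the probability that two linear
classifiers with nonzero parameter vectors `u` and `v` disagree equals
`(1/π)·arccos(⟨u,v⟩/(‖u‖‖v‖))`. -/
theorem gaussian_disagreement_prob (p : ℕ) (u v : Fin p → ℝ) (hu : u ≠ 0) (hv : v ≠ 0) :
    ((Measure.pi fun _ : Fin p => gaussianReal 0 1)
        {x : Fin p → ℝ |
          Real.sign (∑ i, x i * u i) ≠ Real.sign (∑ i, x i * v i)}).toReal
      = (1 / Real.pi) * Real.arccos ((∑ i, u i * v i) /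
          (Real.sqrt (∑ i, u i ^ 2) * Real.sqrt (∑ i, v i ^ 2))) := by
  have sum_pos : ∀ w : Fin p → ℝ, w ≠ 0 → 0 < ∑ i, w i ^ 2 := fun w hw => by
    obtain ⟨i, hi⟩ := Function.ne_iff.1 hw
    exact Finset.sum_pos' (fun _ _ => sq_nonneg _) ⟨i, Finset.mem_univ i, sq_pos_of_ne_zero hi⟩
  have hU := Real.sqrt_pos.2 (sum_pos u hu)
  have hV := Real.sqrt_pos.2 (sum_pos v hv)
  have hUsq := Real.sq_sqrt (sum_pos u hu).le
  have hVsq := Real.sq_sqrt (sum_pos v hv).le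
  have hCS : |∑ i, u i * v i| ≤ √(∑ i, u i ^ 2) * √(∑ i, v i ^ 2) := by
    refine abs_le_of_sq_le_sq ?_ (by positivity)
    rw [mul_pow, hUsq, hVsq]
    exact Finset.sum_mul_sq_le_sq_mul_sq _ _ _
  set U := √(∑ i, u i ^ 2)
  set V := √(∑ i, v i ^ 2)
  set θ := Real.arccos ((∑ i, u i * v i) / (U * V)) with hθ
  have hcos : U * V * Real.cos θ = ∑ i, u i * v i := by
    obtain ⟨h1, h2⟩ := abs_le.1 hCS
    rw [hθ, Real.cos_arccos, mul_div_cancel₀ _ (by positivity)]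
    · rw [le_div_iff₀ (by positivity)]
      linarith
    · rw [div_le_one (by positivity)]
      exact h2
  have hmap := map_pi_gaussianReal_eq_map_prod u v (0, U) (-(V * Real.sin θ), V * Real.cos θ)
    (by simp [hUsq]) (by rw [← hVsq]; linear_combination -V ^ 2 * Real.sin_sq_add_cos_sq θ)
    (by rw [← hcos]; ring)
  let D : Set (ℝ × ℝ) := {y | Real.sign y.1 ≠ Real.sign y.2}
  have hD : MeasurableSet D := (measurableSet_eq_fun (measurable_real_sign.comp measurable_fst)
    (measurable_real_sign.comp measurable_snd)).compl
  have hmD := congrArg (fun μ => μ D) hmap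
  simp only at hmD
  rw [Measure.map_apply (by fun_prop) hD, Measure.map_apply (by fun_prop) hD] at hmD
  change Measure.pi _ {x : Fin p → ℝ | _} = _ at hmD
  rw [prod_gaussianReal_cone (B := {φ | Real.sign (Real.sin φ) ≠ Real.sign (Real.sin (φ - θ))})
    ((by fun_prop : Measurable _) hD)
    (measurableSet_eq_fun (measurable_real_sign.comp (by fun_prop))
      (measurable_real_sign.comp (by fun_prop))).compl,
    volume_sign_sin_ne_sign_sin_sub (Real.arccos_nonneg _) (Real.arccos_le_pi _)] at hmD
  · refine (congrArg ENNReal.toReal hmD).trans ?_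
    rw [ENNReal.toReal_div, ENNReal.toReal_ofReal (mul_nonneg zero_le_two (Real.arccos_nonneg _)),
      ENNReal.toReal_ofReal (by positivity)]
    field_simp
    exact hθ.symm
  · intro r hr φ _
    have h1 : r * Real.cos φ * 0 + r * Real.sin φ * U = r * U * Real.sin φ := by ring
    have h2 : r * Real.cos φ * -(V * Real.sin θ) + r * Real.sin φ * (V * Real.cos θ) =
        r * V * Real.sin (φ - θ) := by
      rw [Real.sin_sub]
      ring
    simp only [D, Set.mem_preimage, Set.mem_ofPred_eq, h1, h2]
    rw [real_sign_mul_of_pos (by positivity), real_sign_mul_of_pos (by positivity)]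
end

section
/- Let E be a finite-dimensional real inner product space, Φ : E → ℝ a convex function, and fix v ∈ E. For t > 0 define m(t) = inf_{x ∈ E} ( Φ(x) + ‖x − v‖²/(2t) ), and let P(t) ∈ E attain this infimum for each t > 0. Then for every t₀ > 0, the function m is differentiable at t₀ with derivative m'(t₀) = −‖v − P(t₀)‖²/(2t₀²). -/
/-- Quadratic growth of a convex function plus `‖· - v‖² / (2t)` around a minimizer. -/
theorem ConvexOn.quadratic_growth_of_prox
    {E : Type*} [NormedAddCommGroup E] [InnerProductSpace ℝ E]
    {Φ : E → ℝ} (hΦ : ConvexOn ℝ Set.univ Φ) {v p : E} {t : ℝ} (ht : 0 < t)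
    (hp : ∀ x : E, Φ p + ‖p - v‖ ^ 2 / (2 * t) ≤ Φ x + ‖x - v‖ ^ 2 / (2 * t)) (x : E) :
    Φ p + ‖p - v‖ ^ 2 / (2 * t) + ‖x - p‖ ^ 2 / (4 * t) ≤ Φ x + ‖x - v‖ ^ 2 / (2 * t) := by
  have hconv := hΦ.2 (Set.mem_univ p) (Set.mem_univ x) (by norm_num : (0 : ℝ) ≤ 1 / 2)
    (by norm_num : (0 : ℝ) ≤ 1 / 2) (by norm_num)
  have hmid := hp ((1 / 2 : ℝ) • p + (1 / 2 : ℝ) • x)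
  have hnorm : ‖(1 / 2 : ℝ) • p + (1 / 2 : ℝ) • x - v‖ ^ 2
      = (‖p - v‖ ^ 2 + ‖x - v‖ ^ 2) / 2 - ‖x - p‖ ^ 2 / 4 := by
    have hsum : (1 / 2 : ℝ) • p + (1 / 2 : ℝ) • x - v
        = (1 / 2 : ℝ) • ((x - v) + (p - v)) := by module
    have hdiff : x - p = (x - v) - (p - v) := by abel
    have hpar := parallelogram_law_with_norm ℝ (x - v) (p - v)
    rw [hsum, hdiff, norm_smul, mul_pow]
    norm_num
    norm_num at hpar
    linarith
  rw [hnorm] at hmid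
  simp only [smul_eq_mul] at hconv
  have hsplit : ((‖p - v‖ ^ 2 + ‖x - v‖ ^ 2) / 2 - ‖x - p‖ ^ 2 / 4) / (2 * t)
      = (‖p - v‖ ^ 2 / (2 * t) + ‖x - v‖ ^ 2 / (2 * t)) / 2 - ‖x - p‖ ^ 2 / (4 * t) / 2 := by
    field_simp
  linarith

/-- Local Lipschitz estimate for the proximal point as a function of the parameter. -/
theorem ConvexOn.norm_prox_sub_prox_le
    {E : Type*} [NormedAddCommGroup E] [InnerProductSpace ℝ E]
    {Φ : E → ℝ} (hΦ : ConvexOn ℝ Set.univ Φ) {v p q : E} {s t : ℝ} (hs : 0 < s)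
    (hst : |t - s| ≤ s / 2)
    (hp : ∀ x : E, Φ p + ‖p - v‖ ^ 2 / (2 * s) ≤ Φ x + ‖x - v‖ ^ 2 / (2 * s))
    (hq : ∀ x : E, Φ q + ‖q - v‖ ^ 2 / (2 * t) ≤ Φ x + ‖x - v‖ ^ 2 / (2 * t)) :
    ‖q - p‖ * s ≤ 8 * ‖p - v‖ * |t - s| := by
  have ht : s / 2 ≤ t := by linarith [(abs_le.mp hst).1]
  have ht0 : 0 < t := by linarith
  have hgp := hΦ.quadratic_growth_of_prox hs hp q
  have hgq := hΦ.quadratic_growth_of_prox ht0 hq p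
  rw [norm_sub_rev p q] at hgq
  have hmono : ‖q - p‖ ^ 2 * (s + t)
      ≤ 2 * ((‖q - v‖ ^ 2 - ‖p - v‖ ^ 2) * (t - s)) := by
    have h : ‖q - p‖ ^ 2 / (4 * s) + ‖q - p‖ ^ 2 / (4 * t)
        ≤ ‖q - v‖ ^ 2 / (2 * s) - ‖p - v‖ ^ 2 / (2 * s)
          + (‖p - v‖ ^ 2 / (2 * t) - ‖q - v‖ ^ 2 / (2 * t)) := by linarith
    have h' := mul_le_mul_of_nonneg_left h (by positivity : 0 ≤ 4 * s * t)
    field_simp at h'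
    linarith
  have habs : |‖q - v‖ - ‖p - v‖| ≤ ‖q - p‖ := by
    simpa using abs_norm_sub_norm_le (q - v) (p - v)
  have hprod : (‖q - v‖ ^ 2 - ‖p - v‖ ^ 2) * (t - s)
      ≤ ‖q - p‖ * (2 * ‖p - v‖ + ‖q - p‖) * |t - s| := by
    calc (‖q - v‖ ^ 2 - ‖p - v‖ ^ 2) * (t - s)
        ≤ |(‖q - v‖ - ‖p - v‖) * (‖q - v‖ + ‖p - v‖) * (t - s)| := by
          refine le_trans (le_of_eq ?_) (le_abs_self _)
          ring
      _ = |‖q - v‖ - ‖p - v‖| * (‖q - v‖ + ‖p - v‖) * |t - s| := by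
          rw [abs_mul, abs_mul, abs_of_nonneg (by positivity : 0 ≤ ‖q - v‖ + ‖p - v‖)]
      _ ≤ _ := by
          have hadd : ‖q - v‖ + ‖p - v‖ ≤ 2 * ‖p - v‖ + ‖q - p‖ := by
            linarith [le_abs_self (‖q - v‖ - ‖p - v‖)]
          gcongr
  rcases (norm_nonneg (q - p)).eq_or_lt with h0 | hpos
  · rw [← h0, zero_mul]
    positivity
  · have h1 : ‖q - p‖ * (s + t) ≤ 2 * (2 * ‖p - v‖ + ‖q - p‖) * |t - s| := by
      refine le_of_mul_le_mul_left ?_ hpos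
      linarith
    have h2 : ‖q - p‖ * |t - s| ≤ ‖q - p‖ * (s / 2) := by gcongr
    have h3 : ‖q - p‖ * (s / 2) ≤ ‖q - p‖ * t := by gcongr
    linarith

/-- Derivative of the Moreau envelope in the parameter: if `Φ : E → ℝ` is convex,
`v ∈ E` is fixed, and for each `t > 0` the point `P t` attains the infimum defining
`m(t) = inf_x (Φ(x) + ‖x - v‖²/(2t))`, then `m` is differentiable at every `t₀ > 0`
with `m'(t₀) = -‖v - P(t₀)‖²/(2t₀²)`. -/
theorem moreau_envelope_hasDerivAt_param
    {E : Type*} [NormedAddCommGroup E] [InnerProductSpace ℝ E] [FiniteDimensional ℝ E]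
    (Φ : E → ℝ) (hΦ : ConvexOn ℝ Set.univ Φ) (v : E)
    (P : ℝ → E)
    (hP : ∀ t : ℝ, 0 < t → ∀ x : E,
      Φ (P t) + ‖P t - v‖ ^ 2 / (2 * t) ≤ Φ x + ‖x - v‖ ^ 2 / (2 * t))
    (t₀ : ℝ) (ht₀ : 0 < t₀) :
    HasDerivAt (fun t => Φ (P t) + ‖P t - v‖ ^ 2 / (2 * t))
      (-(‖v - P t₀‖ ^ 2 / (2 * t₀ ^ 2))) t₀ := by
  have hbig : (fun t => Φ (P t) + ‖P t - v‖ ^ 2 / (2 * t) - (Φ (P t₀) + ‖P t₀ - v‖ ^ 2 / (2 * t)))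
      =O[nhds t₀] fun t => ‖t - t₀‖ ^ 2 := by
    refine Asymptotics.IsBigO.of_bound (48 * ‖P t₀ - v‖ ^ 2 / t₀ ^ 3) ?_
    filter_upwards [Metric.closedBall_mem_nhds t₀ (half_pos ht₀)] with t ht
    rw [Metric.mem_closedBall, Real.dist_eq] at ht
    have hhalf : t₀ / 2 ≤ t := by linarith [(abs_le.mp ht).1]
    have htpos : 0 < t := by linarith
    have hlip := hΦ.norm_prox_sub_prox_le ht₀ ht (hP t₀ ht₀) (hP t htpos)
    have hle := hP t htpos (P t₀)
    have hge := hP t₀ ht₀ (P t)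
    set r := ‖P t₀ - v‖
    set d := ‖P t - P t₀‖
    set a := ‖P t - v‖
    have hr : 0 ≤ r := norm_nonneg _
    have hd : 0 ≤ d := norm_nonneg _
    have ha : 0 ≤ a := norm_nonneg _
    have habs : |a - r| ≤ d := by
      simpa using abs_norm_sub_norm_le (P t - v) (P t₀ - v)
    have hd4 : d ≤ 4 * r := by
      refine le_of_mul_le_mul_right ?_ ht₀
      have : r * |t - t₀| ≤ r * (t₀ / 2) := by gcongr
      linarith
    have hsq : |a ^ 2 - r ^ 2| ≤ 48 * r ^ 2 * |t - t₀| / t₀ := by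
      have h : |a ^ 2 - r ^ 2| ≤ d * (6 * r) := by
        rw [sq_sub_sq, mul_comm, abs_mul, abs_of_nonneg (by positivity : 0 ≤ a + r)]
        gcongr
        linarith [le_abs_self (a - r)]
      rw [le_div_iff₀ ht₀]
      calc |a ^ 2 - r ^ 2| * t₀ ≤ d * (6 * r) * t₀ := by gcongr
        _ = 6 * r * (d * t₀) := by ring
        _ ≤ 6 * r * (8 * r * |t - t₀|) := by gcongr
        _ = _ := by ring
    have hinv : |1 / t - 1 / t₀| ≤ 2 * |t - t₀| / t₀ ^ 2 := by
      rw [div_sub_div _ _ htpos.ne' ht₀.ne', abs_div, abs_of_pos (mul_pos htpos ht₀), one_mul,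
        mul_one, abs_sub_comm, div_le_div_iff₀ (by positivity) (by positivity)]
      have : t₀ * (t₀ / 2) ≤ t₀ * t := by gcongr
      nlinarith [mul_le_mul_of_nonneg_left this (abs_nonneg (t - t₀))]
    have hlow : (a ^ 2 - r ^ 2) / 2 * (1 / t - 1 / t₀)
        ≤ Φ (P t) + a ^ 2 / (2 * t) - (Φ (P t₀) + r ^ 2 / (2 * t)) := by
      have : (a ^ 2 - r ^ 2) / 2 * (1 / t - 1 / t₀)
          = a ^ 2 / (2 * t) - r ^ 2 / (2 * t) - (a ^ 2 / (2 * t₀) - r ^ 2 / (2 * t₀)) := by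
        field_simp
      linarith
    rw [Real.norm_eq_abs, abs_of_nonpos (by linarith), norm_pow, norm_norm, Real.norm_eq_abs]
    calc -(Φ (P t) + a ^ 2 / (2 * t) - (Φ (P t₀) + r ^ 2 / (2 * t)))
        ≤ |(a ^ 2 - r ^ 2) / 2 * (1 / t - 1 / t₀)| := by
          linarith [neg_abs_le ((a ^ 2 - r ^ 2) / 2 * (1 / t - 1 / t₀))]
      _ = |a ^ 2 - r ^ 2| / 2 * |1 / t - 1 / t₀| := by
          rw [abs_mul, abs_div, abs_two]
      _ ≤ 48 * r ^ 2 * |t - t₀| / t₀ / 2 * (2 * |t - t₀| / t₀ ^ 2) := by gcongr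
      _ = 48 * r ^ 2 / t₀ ^ 3 * |t - t₀| ^ 2 := by
          field_simp
  have hzero := (hbig.hasFDerivAt (𝕜 := ℝ) one_lt_two).hasDerivAt
  have hmodel : HasDerivAt (fun t : ℝ => Φ (P t₀) + ‖P t₀ - v‖ ^ 2 / (2 * t))
      (-(‖v - P t₀‖ ^ 2 / (2 * t₀ ^ 2))) t₀ := by
    have h := ((hasDerivAt_inv ht₀.ne').const_mul (‖P t₀ - v‖ ^ 2 / 2)).const_add (Φ (P t₀))
    refine (h.congr_deriv ?_).congr_of_eventuallyEq (.of_forall fun t => ?_)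
    · rw [norm_sub_rev]
      field_simp
    · simp only [div_eq_mul_inv, mul_inv, mul_assoc]
  refine ((hzero.add hmodel).congr_deriv ?_).congr_of_eventuallyEq (.of_forall fun t => ?_)
  · simp
  · simp
end

section
/- Let c > 0 and u ∈ ℝ^p with Σ_{i=1}^p |u_i| > c. Then there exists a unique λ > 0 such that Σ_{i=1}^p (|u_i| − λ)₊ = c, and the unique minimizer over ℝ^p of x ↦ c·max_i |x_i| + (1/2)·‖x − u‖² is the vector x* with coordinates x*_i = u_i − sign(u_i)·(|u_i| − λ)₊ (equivalently, x*_i = sign(u_i)·min(|u_i|, λ)); that is, Prox_{c‖·‖_∞}(u) = u − η(u, λ). -/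
open Finset in
/-- The residual mass `∑ᵢ (aᵢ - l)₊` is strictly decreasing in `l` where it is positive. -/
lemma sum_max_sub_lt_sum_max_sub {ι : Type*} [Fintype ι] (a : ι → ℝ) {l m : ℝ} (hlm : l < m)
    (hpos : 0 < ∑ i, max (a i - m) 0) :
    ∑ i, max (a i - m) 0 < ∑ i, max (a i - l) 0 := by
  obtain ⟨i, -, hi⟩ : ∃ i ∈ univ, 0 < max (a i - m) 0 := by
    by_contra! h
    exact hpos.not_ge (sum_nonpos h)
  refine sum_lt_sum (fun j _ => max_le_max (by linarith) le_rfl) ⟨i, mem_univ i, ?_⟩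
  have him : 0 < a i - m := by simpa using hi
  rw [max_eq_left him.le]
  exact lt_max_of_lt_left (by linarith)

/-- If `0 < c < ∑ᵢ aᵢ` with `a ≥ 0`, the equation `∑ᵢ (aᵢ - l)₊ = c` has a unique positive
solution. -/
lemma existsUnique_sum_max_sub_eq {ι : Type*} [Fintype ι] {a : ι → ℝ} (ha : ∀ i, 0 ≤ a i)
    {c : ℝ} (hc : 0 < c) (hac : c < ∑ i, a i) :
    ∃! l : ℝ, 0 < l ∧ ∑ i, max (a i - l) 0 = c := by
  have hcont : Continuous fun l : ℝ => ∑ i, max (a i - l) 0 := by fun_prop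
  have h_zero : ∑ i, max (a i - 0) 0 = ∑ i, a i := by simp [ha]
  have h_top : ∑ i, max (a i - ∑ j, a j) 0 = 0 :=
    Finset.sum_eq_zero fun i _ => max_eq_right <|
      sub_nonpos.2 <| Finset.single_le_sum (fun j _ => ha j) (Finset.mem_univ i)
  obtain ⟨l, hl, hlc⟩ := intermediate_value_Ioo' (hc.trans hac).le hcont.continuousOn
    (show c ∈ Set.Ioo _ _ from ⟨h_top.trans_lt hc, hac.trans_eq h_zero.symm⟩)
  refine ⟨l, ⟨hl.1, hlc⟩, fun m ⟨_, hmc⟩ => ?_⟩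
  simp only at hlc
  rcases lt_trichotomy m l with h | h | h
  · have := sum_max_sub_lt_sum_max_sub a h (hlc ▸ hc)
    linarith
  · exact h
  · have := sum_max_sub_lt_sum_max_sub a h (hmc ▸ hc)
    linarith

lemma abs_sign_mul_max_sub {l : ℝ} (hl : 0 < l) (t : ℝ) :
    |Real.sign t * max (|t| - l) 0| = max (|t| - l) 0 := by
  rcases lt_trichotomy t 0 with h | rfl | h
  · simp [Real.sign_of_neg h]
  · simp [hl.le]
  · simp [Real.sign_of_pos h]

lemma abs_sub_sign_mul_max_sub_le {l : ℝ} (hl : 0 < l) (t : ℝ) :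
    |t - Real.sign t * max (|t| - l) 0| ≤ l := by
  rcases lt_trichotomy t 0 with h | rfl | h
  · rw [Real.sign_of_neg h, abs_of_neg h]
    rcases max_cases (-t - l) 0 with ⟨h1, h2⟩ | ⟨h1, h2⟩ <;> rw [h1, abs_le] <;>
      constructor <;> linarith
  · simp [hl.le]
  · rw [Real.sign_of_pos h, abs_of_pos h]
    rcases max_cases (t - l) 0 with ⟨h1, h2⟩ | ⟨h1, h2⟩ <;> rw [h1, abs_le] <;>
      constructor <;> linarith

lemma sub_mul_sign_mul_max_sub {l : ℝ} (hl : 0 < l) (t : ℝ) :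
    (t - Real.sign t * max (|t| - l) 0) * (Real.sign t * max (|t| - l) 0)
      = l * max (|t| - l) 0 := by
  rcases lt_trichotomy t 0 with h | rfl | h
  · rw [Real.sign_of_neg h, abs_of_neg h]
    rcases max_cases (-t - l) 0 with ⟨h1, _⟩ | ⟨h1, _⟩ <;> rw [h1] <;> ring
  · simp [hl.le]
  · rw [Real.sign_of_pos h, abs_of_pos h]
    rcases max_cases (t - l) 0 with ⟨h1, _⟩ | ⟨h1, _⟩ <;> rw [h1] <;> ring

/-- Quadratic growth of the `ℓ∞`-proximal objective around its minimizer. -/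
lemma prox_linf_quadratic_growth {ι : Type*} [Fintype ι] {c l : ℝ} (hc : 0 ≤ c) (hl : 0 < l)
    (u : ι → ℝ) (hlc : ∑ i, max (|u i| - l) 0 = c) (x : ι → ℝ) :
    c * (⨆ i, |u i - Real.sign (u i) * max (|u i| - l) 0|)
        + (1 / 2) * ∑ i, ((u i - Real.sign (u i) * max (|u i| - l) 0) - u i) ^ 2
        + (1 / 2) * ∑ i, (x i - (u i - Real.sign (u i) * max (|u i| - l) 0)) ^ 2
      ≤ c * (⨆ i, |x i|) + (1 / 2) * ∑ i, (x i - u i) ^ 2 := by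
  have h_sup : c * (⨆ i, |u i - Real.sign (u i) * max (|u i| - l) 0|) ≤ c * l :=
    mul_le_mul_of_nonneg_left
      (Real.iSup_le (fun i => abs_sub_sign_mul_max_sub_le hl (u i)) hl.le) hc
  have h_dual : ∑ i, x i * (Real.sign (u i) * max (|u i| - l) 0) ≤ c * ⨆ i, |x i| := by
    rw [← hlc, Finset.sum_mul]
    refine Finset.sum_le_sum fun i _ => (le_abs_self _).trans ?_
    rw [abs_mul, abs_sign_mul_max_sub hl, mul_comm]
    exact mul_le_mul_of_nonneg_left
      (le_ciSup (f := fun i => |x i|) (Set.finite_range _).bddAbove i) (le_max_right _ _)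
  have h_attain : ∑ i, (u i - Real.sign (u i) * max (|u i| - l) 0)
      * (Real.sign (u i) * max (|u i| - l) 0) = c * l := by
    simp_rw [sub_mul_sign_mul_max_sub hl, ← Finset.mul_sum, hlc, mul_comm]
  have h_expand : (1 / 2) * ∑ i, (x i - u i) ^ 2
      = (1 / 2) * ∑ i, ((u i - Real.sign (u i) * max (|u i| - l) 0) - u i) ^ 2
        + (1 / 2) * ∑ i, (x i - (u i - Real.sign (u i) * max (|u i| - l) 0)) ^ 2
        - ∑ i, x i * (Real.sign (u i) * max (|u i| - l) 0)
        + ∑ i, (u i - Real.sign (u i) * max (|u i| - l) 0)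
          * (Real.sign (u i) * max (|u i| - l) 0) := by
    simp only [Finset.mul_sum, ← Finset.sum_add_distrib, ← Finset.sum_sub_distrib]
    exact Finset.sum_congr rfl fun i _ => by ring
  linarith


/-- λ-characterization of the proximal operator of the `ℓ∞`-norm: if `‖u‖₁ > c > 0`,
there is a unique `λ > 0` with `Σᵢ (|uᵢ| - λ)₊ = c`, and for this `λ` the unique
minimizer of `x ↦ c·maxᵢ |xᵢ| + (1/2)‖x - u‖²` is the vector with coordinates
`uᵢ - sign(uᵢ)·(|uᵢ| - λ)₊`; i.e. `Prox_{c‖·‖∞}(u) = u - η(u, λ)`. -/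
theorem prox_linf_lambda_characterization (p : ℕ) (c : ℝ) (hc : 0 < c)
    (u : Fin p → ℝ) (hu : c < ∑ i, |u i|) :
    (∃! l : ℝ, 0 < l ∧ ∑ i, max (|u i| - l) 0 = c) ∧
    (∀ l : ℝ, 0 < l → (∑ i, max (|u i| - l) 0 = c) →
      (∀ x : Fin p → ℝ,
        c * (⨆ i, |u i - Real.sign (u i) * max (|u i| - l) 0|)
            + (1 / 2) * ∑ i, ((u i - Real.sign (u i) * max (|u i| - l) 0) - u i) ^ 2
          ≤ c * (⨆ i, |x i|) + (1 / 2) * ∑ i, (x i - u i) ^ 2) ∧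
      (∀ x : Fin p → ℝ,
        c * (⨆ i, |x i|) + (1 / 2) * ∑ i, (x i - u i) ^ 2
            = c * (⨆ i, |u i - Real.sign (u i) * max (|u i| - l) 0|)
              + (1 / 2) * ∑ i, ((u i - Real.sign (u i) * max (|u i| - l) 0) - u i) ^ 2
          → x = fun i => u i - Real.sign (u i) * max (|u i| - l) 0)) := by
  refine ⟨existsUnique_sum_max_sub_eq (fun i => abs_nonneg (u i)) hc hu,
    fun l hl hlc => ⟨fun x => ?_, fun x hx => ?_⟩⟩
  · have h_growth := prox_linf_quadratic_growth hc.le hl u hlc x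
    have h_nonneg : 0 ≤ ∑ i, (x i - (u i - Real.sign (u i) * max (|u i| - l) 0)) ^ 2 :=
      Finset.sum_nonneg fun i _ => sq_nonneg _
    linarith
  · have h_growth := prox_linf_quadratic_growth hc.le hl u hlc x
    have h_nonpos : ∑ i, (x i - (u i - Real.sign (u i) * max (|u i| - l) 0)) ^ 2 ≤ 0 := by
      linarith
    funext i
    have h_le := Finset.single_le_sum
      (f := fun i => (x i - (u i - Real.sign (u i) * max (|u i| - l) 0)) ^ 2)
      (fun j _ => sq_nonneg _) (Finset.mem_univ i)
    exact sub_eq_zero.1 (pow_eq_zero_iff two_ne_zero |>.1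
      (le_antisymm (h_le.trans h_nonpos) (sq_nonneg _)))
end
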